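/- (Characterization of the Kato–Matsuda filtration inside the Brylinski–Kato filtration via F^{n−1}d, from the proof of the trace estimate in §3.) Let k be a perfect field of characteristic p, A a smooth integral k-algebra with fraction field L, P ⊂ A a height-one prime ideal, O := A_P (a discrete valuation ring) with maximal ideal 𝔪 and uniformizer z. Then for every n ≥ 1 and s ≥ 1: (i) F^{n−1}d(fil^log_s Wₙ(L)) ⊆ 𝔪^{−s}·Ω¹_O(log); (ii) F^{n−1}d(fil_s Wₙ(L)) ⊆ 𝔪^{−s}·Ω¹_O; and (iii) conversely, if a ∈ fil^log_s Wₙ(L) satisfies F^{n−1}d(a) ∈ 𝔪^{−s}·Ω¹_O, then a ∈ fil_s Wₙ(L). -/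

import Mathlib

noncomputable section

open scoped Classical

/-- A discretely valued field: a field `L` together with a normalized additive valuation
`v : L → ℤ ∪ {∞}` and a uniformizer `z` (so `v z = 1`).  The valuation ring is
`O = {a : L | 0 ≤ v a}`, with maximal ideal `𝔪 = {a : L | 1 ≤ v a}`. -/
structure DVField (L : Type) [Field L] : Type where
  v : L → WithTop ℤ
  z : L
  v_top : ∀ a : L, v a = ⊤ ↔ a = 0
  v_mul : ∀ a b : L, v (a * b) = v a + v b
  v_add : ∀ a b : L, min (v a) (v b) ≤ v (a + b)
  v_z : v z = 1

namespace DVField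

variable {L : Type} [Field L]

/-- `Wₙ(O) ⊆ Wₙ(L)`: the truncated Witt vectors all of whose components are integral. -/
def WO (D : DVField L) (p n : ℕ) : Set (TruncatedWittVector p n L) :=
  {x | ∀ i : Fin n, 0 ≤ D.v (x.coeff i)}

/-- The Brylinski–Kato filtration
`fil^log_r Wₙ(L) = {(a₀, …, a_{n-1}) | p^{n-1-i} · v(aᵢ) ≥ -r for all i}`. -/
def filLog (D : DVField L) (p r n : ℕ) : Set (TruncatedWittVector p n L) :=
  {x | ∀ i : Fin n, (↑(-(r : ℤ)) : WithTop ℤ) ≤ p ^ (n - 1 - (i : ℕ)) • D.v (x.coeff i)}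

end DVField

/-- The Verschiebung `V : Wₙ(L) → W_{n+1}(L)`, shifting components. -/
def wV {p : ℕ} {L : Type} [Field L] {n : ℕ} (x : TruncatedWittVector p n L) :
    TruncatedWittVector p (n + 1) L :=
  TruncatedWittVector.mk p fun i =>
    if h : (i : ℕ) = 0 then 0 else x.coeff ⟨(i : ℕ) - 1, by have := i.isLt; omega⟩

/-- The iterated Verschiebung `V^{n-m} : W_m(L) → Wₙ(L)` (for `m ≤ n`), given by shifting
components by `n - m`. -/
def wVit {p : ℕ} {L : Type} [Field L] {m n : ℕ} (x : TruncatedWittVector p m L) :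
    TruncatedWittVector p n L :=
  TruncatedWittVector.mk p fun i =>
    if h : n - m ≤ (i : ℕ) ∧ (i : ℕ) - (n - m) < m then x.coeff ⟨(i : ℕ) - (n - m), h.2⟩ else 0

/-- The restriction `R : W_{n+1}(L) → Wₙ(L)`, dropping the last component. -/
def wR {p : ℕ} {L : Type} [Field L] {n : ℕ} (x : TruncatedWittVector p (n + 1) L) :
    TruncatedWittVector p n L :=
  TruncatedWittVector.mk p fun i => x.coeff i.castSucc

/-- The iterated restriction `R^{m-n} : W_m(L) → Wₙ(L)` (for `n ≤ m`), keeping the first `n`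
components. -/
def wRes {p : ℕ} {L : Type} [Field L] {m n : ℕ} (x : TruncatedWittVector p m L) :
    TruncatedWittVector p n L :=
  TruncatedWittVector.mk p fun i => if h : (i : ℕ) < m then x.coeff ⟨(i : ℕ), h⟩ else 0

/-- The Frobenius `F : W_{n+1}(L) → Wₙ(L)` in characteristic `p`:
componentwise `p`-th power followed by restriction. -/
def wF {p : ℕ} {L : Type} [Field L] {n : ℕ} (x : TruncatedWittVector p (n + 1) L) :
    TruncatedWittVector p n L :=
  TruncatedWittVector.mk p fun i => x.coeff i.castSucc ^ p

/-- The Teichmüller lift `[a] = (a, 0, …, 0)`. -/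
def wT (p : ℕ) {L : Type} [Field L] (n : ℕ) (a : L) : TruncatedWittVector p n L :=
  TruncatedWittVector.mk p fun i => if (i : ℕ) = 0 then a else 0

/-- The map `p̲ : Wₙ(L) → W_{n+1}(L)`: lift to length `n+1` (by appending a zero component)
and multiply by `p`. -/
def wP {p : ℕ} [Fact p.Prime] {L : Type} [Field L] {n : ℕ} (x : TruncatedWittVector p n L) :
    TruncatedWittVector p (n + 1) L :=
  p • (wRes x : TruncatedWittVector p (n + 1) L)

namespace DVField

variable {L : Type} [Field L]

/-- The Kato–Matsuda filtration
`fil_r Wₙ(L) = fil^log_{r-1} Wₙ(L) + V^{n-m}(fil^log_r W_m(L))` where `m = min(v_p(r), n)`,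
and `fil_0 Wₙ(L) = Wₙ(O)`. -/
def filKM (D : DVField L) (p : ℕ) [Fact p.Prime] (r n : ℕ) :
    Set (TruncatedWittVector p n L) :=
  if r = 0 then D.WO p n
  else {x | ∃ a ∈ D.filLog p (r - 1) n,
    ∃ b ∈ D.filLog p r (min (padicValNat p r) n), x = a + wVit b}

/-- The `p`-saturation `Fil^p_r Wₙ(L) = Σ_{s=0}^{n-1} p^s · fil_{r·p^s} Wₙ(L)`. -/
def FilP (D : DVField L) (p : ℕ) [Fact p.Prime] (r n : ℕ) :
    Set (TruncatedWittVector p n L) :=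
  {x | ∃ f : Fin n → TruncatedWittVector p n L,
      (∀ s : Fin n, f s ∈ D.filKM p (r * p ^ (s : ℕ)) n) ∧
      x = ∑ s : Fin n, p ^ (s : ℕ) • f s}

end DVField

namespace DVField

variable {L : Type} [Field L]

/-- `Ω¹_O ⊆ Ω¹_L`: the image of the Kähler differentials of the valuation ring `O` in
`Ω¹_L = Ω[L⁄k]`, i.e. the additive subgroup generated by the elements `a • d b` with
`a, b ∈ O` (i.e. `v a ≥ 0` and `v b ≥ 0`). -/
def OmegaO (D : DVField L) (k : Type) [CommRing k] [Algebra k L] : AddSubgroup (Ω[L⁄k]) :=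
  AddSubgroup.closure
    {ω | ∃ a b : L, 0 ≤ D.v a ∧ 0 ≤ D.v b ∧ ω = a • (KaehlerDifferential.D k L) b}

/-- `Ω¹_O(log) = Ω¹_O + O · dlog z ⊆ Ω¹_L`, where `dlog z = z⁻¹ • d z`. -/
def OmegaOLog (D : DVField L) (k : Type) [CommRing k] [Algebra k L] : AddSubgroup (Ω[L⁄k]) :=
  AddSubgroup.closure
    ({ω | ∃ a b : L, 0 ≤ D.v a ∧ 0 ≤ D.v b ∧ ω = a • (KaehlerDifferential.D k L) b} ∪
      {ω | ∃ a : L, 0 ≤ D.v a ∧ ω = a • (D.z⁻¹ • (KaehlerDifferential.D k L) D.z)})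

end DVField

/-- The map `F^{n-1}d : Wₙ(L) → Ω¹_L`, `(a₀, …, a_{n-1}) ↦ Σᵢ aᵢ^{p^{n-1-i}-1} • daᵢ`
(the component formula for the composite of the de Rham–Witt differential with the
`(n-1)`-fold Frobenius). -/
def wFd (p : ℕ) (k : Type) [CommRing k] {L : Type} [Field L] [Algebra k L] {n : ℕ}
    (x : TruncatedWittVector p n L) : Ω[L⁄k] :=
  ∑ i : Fin n, x.coeff i ^ (p ^ (n - 1 - (i : ℕ)) - 1) • (KaehlerDifferential.D k L) (x.coeff i)


/-- `F^{n-1}d` on full Witt vectors over arbitrary rings. -/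
def gFd (p : ℕ) (k : Type) [CommRing k] {R : Type} [CommRing R] [Algebra k R] (n : ℕ)
    (x : WittVector p R) : Ω[R⁄k] :=
  ∑ i ∈ Finset.range n, x.coeff i ^ (p ^ (n - 1 - i) - 1) • (KaehlerDifferential.D k R) (x.coeff i)

theorem gFd_ghost (p : ℕ) [Fact p.Prime] (k : Type) [CommRing k] {R : Type} [CommRing R]
    [Algebra k R] (n : ℕ) (x : WittVector p R) :
    (p ^ n) • gFd p k (n + 1) x =
      KaehlerDifferential.D k R (WittVector.ghostComponent n x) := by
  rw [WittVector.ghostComponent_apply, aeval_wittPolynomial, map_sum, gFd, Finset.smul_sum]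
  refine Finset.sum_congr rfl fun i hi => ?_
  have hi' : i ≤ n := by simpa [Nat.lt_succ_iff] using hi
  have h1 : ((p : R) ^ i * x.coeff i ^ p ^ (n - i)) = (p ^ i) • (x.coeff i ^ p ^ (n - i)) := by
    rw [nsmul_eq_mul]; push_cast; rfl
  rw [h1, map_nsmul, Derivation.leibniz_pow, smul_smul, ← pow_add]
  congr 2
  omega

theorem gFd_map (p : ℕ) [Fact p.Prime] (Z k : Type) [CommRing Z] [CommRing k] {R L : Type}
    [CommRing R] [CommRing L] [Algebra Z R] [Algebra Z k] [Algebra Z L] [Algebra k L]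
    [IsScalarTower Z k L] (g : R →+* L) (hg : algebraMap Z L = g.comp (algebraMap Z R)) (n : ℕ) :
    ∃ G : Ω[R⁄Z] →+ Ω[L⁄k], ∀ x : WittVector p R,
      G (gFd p Z n x) = gFd p k n (WittVector.map g x) := by
  let _ : Algebra R L := g.toAlgebra
  have : IsScalarTower Z R L := IsScalarTower.of_algebraMap_eq' hg
  refine ⟨(KaehlerDifferential.map Z k R L).toAddMonoidHom, fun x => ?_⟩
  have hg : algebraMap R L = g := rfl
  simp only [gFd, LinearMap.toAddMonoidHom_coe, map_sum, map_smul, KaehlerDifferential.map_D,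
    WittVector.map_coeff, ← hg, ← map_pow, algebraMap_smul]

theorem gFd_add (p : ℕ) [Fact p.Prime] (k : Type) [CommRing k] {L : Type} [CommRing L]
    [Algebra k L] (n : ℕ) (x y : WittVector p L) :
    gFd p k n (x + y) = gFd p k n x + gFd p k n y := by
  rcases n with _ | n
  · simp [gFd]
  let X : WittVector p (MvPolynomial (Fin 2 × ℕ) ℤ) := WittVector.mk p fun i => MvPolynomial.X (0, i)
  let Y : WittVector p (MvPolynomial (Fin 2 × ℕ) ℤ) := WittVector.mk p fun i => MvPolynomial.X (1, i)
  let g : MvPolynomial (Fin 2 × ℕ) ℤ →+* L := MvPolynomial.eval₂Hom (Int.castRingHom L)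
    (fun q => if q.1 = 0 then x.coeff q.2 else y.coeff q.2)
  have hX : WittVector.map g X = x := by
    ext i; simp [X, g, WittVector.map_coeff]
  have hY : WittVector.map g Y = y := by
    ext i; simp [Y, g, WittVector.map_coeff]
  have key : gFd p ℤ (n + 1) (X + Y) = gFd p ℤ (n + 1) X + gFd p ℤ (n + 1) Y := by
    have h : (p ^ n) • gFd p ℤ (n + 1) (X + Y) =
        (p ^ n) • (gFd p ℤ (n + 1) X + gFd p ℤ (n + 1) Y) := by
      rw [smul_add, gFd_ghost, gFd_ghost, gFd_ghost, map_add, map_add]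
    apply (KaehlerDifferential.mvPolynomialBasis ℤ (Fin 2 × ℕ)).repr.injective
    ext1 q
    have h2 := congrArg (fun w => (KaehlerDifferential.mvPolynomialBasis ℤ (Fin 2 × ℕ)).repr w q) h
    simp only [map_nsmul, Finsupp.smul_apply] at h2
    have hp : p ^ n ≠ 0 := pow_ne_zero _ (Fact.out : p.Prime).ne_zero
    exact smul_right_injective _ hp h2
  obtain ⟨G, hG⟩ := gFd_map p ℤ k g (RingHom.ext_int _ _) (n + 1)
  rw [← hX, ← hY, ← map_add, ← hG, ← hG, ← hG, key, map_add]

theorem wFd_truncate (p : ℕ) [Fact p.Prime] (k : Type) [CommRing k] {L : Type} [Field L]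
    [Algebra k L] (n : ℕ) (x : WittVector p L) :
    wFd p k (WittVector.truncate n x) = gFd p k n x := by
  simp only [wFd, gFd, WittVector.coeff_truncate]
  exact Fin.sum_univ_eq_sum_range
    (fun i => x.coeff i ^ (p ^ (n - 1 - i) - 1) • (KaehlerDifferential.D k L) (x.coeff i)) n

theorem wFd_add (p : ℕ) [Fact p.Prime] (k : Type) [CommRing k] {L : Type} [Field L]
    [Algebra k L] {n : ℕ} (x y : TruncatedWittVector p n L) :
    wFd p k (x + y) = wFd p k x + wFd p k y := by
  obtain ⟨x, rfl⟩ := WittVector.truncate_surjective p n L x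
  obtain ⟨y, rfl⟩ := WittVector.truncate_surjective p n L y
  rw [← map_add, wFd_truncate, wFd_truncate, wFd_truncate, gFd_add]

theorem tw_add_disjoint (p : ℕ) [Fact p.Prime] {L : Type} [Field L]
    {n : ℕ} (x y : TruncatedWittVector p n L) (h : ∀ i, x.coeff i = 0 ∨ y.coeff i = 0)
    (i : Fin n) : (x + y).coeff i = x.coeff i + y.coeff i := by
  have hx : x = WittVector.truncate n x.out := (TruncatedWittVector.truncateFun_out x).symm
  have hy : y = WittVector.truncate n y.out := (TruncatedWittVector.truncateFun_out y).symm
  conv_lhs => rw [hx, hy, ← map_add, WittVector.coeff_truncate]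
  rw [WittVector.coeff_add_of_disjoint, TruncatedWittVector.coeff_out,
    TruncatedWittVector.coeff_out]
  intro j
  by_cases hj : j < n
  · simpa [TruncatedWittVector.out, hj] using h ⟨j, hj⟩
  · left; simp [TruncatedWittVector.out, hj]

/-- A functional on the differentials of a discrete valuation ring not vanishing on the
uniformizer modulo the maximal ideal. -/
theorem exists_functional (k O : Type) [Field k] [CommRing O] [Algebra k O]
    [Algebra.FormallySmooth k O] (m : Ideal O) [Algebra.FormallySmooth k (O ⧸ m)]
    (z : O) (hm : m = Ideal.span {z}) (hz : z ∉ m ^ 2) :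
    ∃ φ : Ω[O⁄k] →ₗ[O] O, φ (KaehlerDifferential.D k O z) ∉ m := by
  set I := RingHom.ker (algebraMap O (O ⧸ m)) with hI
  obtain ⟨l, hl⟩ := (Algebra.FormallySmooth.iff_split_injection (R := k) (P := O) (A := O ⧸ m)
    Ideal.Quotient.mk_surjective).mp inferInstance
  have hIm : I = m := Ideal.mk_ker
  have hzI : z ∈ I := by rw [hIm, hm]; exact Ideal.mem_span_singleton_self z
  let f : Ω[O⁄k] →ₗ[O] I.Cotangent := l ∘ₗ (TensorProduct.mk O (O ⧸ m) Ω[O⁄k] 1)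
  let g : O →ₗ[O] I.Cotangent := LinearMap.toSpanSingleton O _ (I.toCotangent ⟨z, hzI⟩)
  have hg : Function.Surjective g := by
    intro c
    obtain ⟨⟨c, hc⟩, rfl⟩ := I.toCotangent_surjective c
    have hc' : c ∈ Ideal.span {z} := by rw [← hm, ← hIm]; exact hc
    obtain ⟨a, rfl⟩ := Ideal.mem_span_singleton'.mp hc'
    refine ⟨a, ?_⟩
    simp only [g, LinearMap.toSpanSingleton_apply, ← map_smul]
    rfl
  obtain ⟨φ, hφ⟩ := Module.projective_lifting_property g f hg
  refine ⟨φ, fun h => hz ?_⟩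
  have h1 : f (KaehlerDifferential.D k O z) = I.toCotangent ⟨z, hzI⟩ :=
    LinearMap.congr_fun hl (I.toCotangent ⟨z, hzI⟩)
  have h2 := LinearMap.congr_fun hφ (KaehlerDifferential.D k O z)
  rw [LinearMap.comp_apply, h1] at h2
  simp only [g, LinearMap.toSpanSingleton_apply, ← map_smul] at h2
  rw [Ideal.toCotangent_eq] at h2
  simp only [SetLike.val_smul, smul_eq_mul] at h2
  rw [hIm] at h2 hzI
  have h3 : φ (KaehlerDifferential.D k O z) * z ∈ m ^ 2 := by
    rw [pow_two]; exact Ideal.mul_mem_mul h hzI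
  have := sub_mem h3 h2
  simpa using this

namespace DVField

variable {L : Type} [Field L] (D : DVField L)

theorem v_one : D.v 1 = 0 := by
  have h := D.v_mul 1 1
  have h1 : D.v 1 ≠ ⊤ := fun h => one_ne_zero ((D.v_top 1).mp h)
  obtain ⟨j, hj⟩ := WithTop.ne_top_iff_exists.mp h1
  rw [mul_one, ← hj] at h
  rw [← hj]
  norm_cast at h ⊢
  omega

theorem exists_v {a : L} (ha : a ≠ 0) : ∃ j : ℤ, D.v a = j := by
  have h1 : D.v a ≠ ⊤ := fun h => ha ((D.v_top a).mp h)
  obtain ⟨j, hj⟩ := WithTop.ne_top_iff_exists.mp h1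
  exact ⟨j, hj.symm⟩

theorem v_zero : D.v 0 = ⊤ := (D.v_top 0).mpr rfl

theorem ne_zero_of_v {a : L} {j : ℤ} (h : D.v a = j) : a ≠ 0 := by
  rintro rfl
  rw [v_zero] at h
  exact WithTop.top_ne_coe h

theorem v_mul_of {a b : L} {i j : ℤ} (ha : D.v a = i) (hb : D.v b = j) :
    D.v (a * b) = ((i + j : ℤ) : WithTop ℤ) := by
  rw [D.v_mul, ha, hb]; rfl

theorem v_inv_of {a : L} {i : ℤ} (ha : D.v a = i) :
    D.v a⁻¹ = ((-i : ℤ) : WithTop ℤ) := by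
  have h0 := D.ne_zero_of_v ha
  obtain ⟨j, hj⟩ := D.exists_v (inv_ne_zero h0)
  have := D.v_mul_of ha hj
  rw [mul_inv_cancel₀ h0, v_one] at this
  rw [hj]
  norm_cast at this ⊢
  omega

theorem v_pow_of {a : L} {i : ℤ} (ha : D.v a = i) (n : ℕ) :
    D.v (a ^ n) = ((n * i : ℤ) : WithTop ℤ) := by
  induction n with
  | zero => simp [v_one]
  | succ n ih =>
    rw [pow_succ, D.v_mul_of ih ha]
    congr 1
    push_cast
    ring

theorem v_z_coe : D.v D.z = ((1 : ℤ) : WithTop ℤ) := D.v_z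

theorem z_ne : D.z ≠ 0 := D.ne_zero_of_v D.v_z_coe

theorem v_zpow_z (j : ℤ) : D.v (D.z ^ j) = (j : WithTop ℤ) := by
  obtain ⟨n, rfl | rfl⟩ := j.eq_nat_or_neg
  · rw [zpow_natCast, D.v_pow_of D.v_z_coe]; simp
  · rw [zpow_neg, zpow_natCast, D.v_inv_of (D.v_pow_of D.v_z_coe n)]; simp

theorem v_neg (a : L) : D.v (-a) = D.v a := by
  have h1 : D.v (-1) = 0 := by
    obtain ⟨j, hj⟩ := D.exists_v (a := (-1 : L)) (by simp)
    have := D.v_mul_of hj hj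
    rw [neg_mul_neg, one_mul, v_one] at this
    rw [hj]
    norm_cast at this ⊢
    omega
  rw [← neg_one_mul, D.v_mul, h1, zero_add]

/-- The valuation ring as a subring. -/
def oring : Subring L where
  carrier := {x | 0 ≤ D.v x}
  mul_mem' {a b} ha hb := by
    simp only [Set.mem_ofPred_eq] at ha hb ⊢
    rw [D.v_mul]; exact add_nonneg ha hb
  one_mem' := by simp [v_one]
  add_mem' {a b} ha hb := le_trans (le_min ha hb) (D.v_add a b)
  zero_mem' := by simp [v_zero]
  neg_mem' {a} ha := by
    simp only [Set.mem_ofPred_eq] at ha ⊢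
    rwa [v_neg]

theorem mem_oring {x : L} : x ∈ D.oring ↔ 0 ≤ D.v x := Iff.rfl

/-- The valuation ring as a subalgebra. -/
def oalg (A : Type) [CommRing A] [Algebra A L] (hA1 : ∀ a : A, 0 ≤ D.v (algebraMap A L a)) :
    Subalgebra A L where
  toSubsemiring := D.oring.toSubsemiring
  algebraMap_mem' := hA1

theorem one_le_v_iff {x : L} : 1 ≤ D.v x ↔ 0 ≤ D.v (x / D.z) := by
  by_cases hx : x = 0
  · simp [hx, v_zero]
  obtain ⟨j, hj⟩ := D.exists_v hx
  rw [div_eq_mul_inv, D.v_mul_of hj (D.v_inv_of D.v_z_coe), hj]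
  norm_cast
  omega

theorem dlog_notMem (p : ℕ) [Fact p.Prime]
    (k : Type) [Field k] [CharP k p] [PerfectField k]
    (A : Type) [CommRing A] [IsDomain A] [Algebra k A] [Algebra.Smooth k A]
    [Algebra A L] [IsFractionRing A L]
    [Algebra k L] [IsScalarTower k A L]
    (hA1 : ∀ a : A, 0 ≤ D.v (algebraMap A L a))
    (hA2 : ∀ x : L, 0 ≤ D.v x → ∃ a b : A,
      D.v (algebraMap A L b) = 0 ∧ x * algebraMap A L b = algebraMap A L a) :
    D.z⁻¹ • KaehlerDifferential.D k L D.z ∉ D.OmegaO k := by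
  let O := D.oalg A hA1
  have memO : ∀ x : L, x ∈ O ↔ 0 ≤ D.v x := fun x => Iff.rfl
  let M : Submonoid A :=
    { carrier := {b | D.v (algebraMap A L b) = 0}
      mul_mem' := by
        intro a b ha hb
        simp only [Set.mem_ofPred_eq] at ha hb ⊢
        rw [map_mul, D.v_mul, ha, hb, add_zero]
      one_mem' := by simp [v_one] }
  have memM : ∀ b : A, b ∈ M ↔ D.v (algebraMap A L b) = 0 := fun b => Iff.rfl
  have unitO : ∀ x : O, D.v x = 0 → IsUnit x := by
    intro x hx
    have hx' : D.v (x : L) = ((0 : ℤ) : WithTop ℤ) := hx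
    have hinv := D.v_inv_of hx'
    refine IsUnit.of_mul_eq_one ⟨(x : L)⁻¹, (memO _).mpr (by rw [hinv]; simp)⟩ ?_
    apply Subtype.ext
    exact mul_inv_cancel₀ (D.ne_zero_of_v hx')
  have hloc : IsLocalization M O := by
    refine ⟨?_, ?_, ?_⟩
    · intro y
      exact unitO _ y.2
    · intro x
      obtain ⟨a, b, hb, hab⟩ := hA2 x x.2
      exact ⟨⟨a, ⟨b, hb⟩⟩, Subtype.ext hab⟩
    · intro a b hab
      refine ⟨1, ?_⟩
      have : algebraMap A L a = algebraMap A L b := congrArg Subtype.val hab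
      rw [IsFractionRing.injective A L this]
  have hfrac : IsFractionRing O L :=
    IsFractionRing.isFractionRing_of_isDomain_of_isLocalization M O L
  have h1 : Algebra.FormallySmooth A O := Algebra.FormallySmooth.of_isLocalization M
  have h2 : Algebra.FormallySmooth k O := Algebra.FormallySmooth.comp k A O
  have h3 : Algebra.EssFiniteType A O := Algebra.EssFiniteType.of_isLocalization _ M
  have h4 : Algebra.EssFiniteType k O := Algebra.EssFiniteType.comp k A O
  let z : O := ⟨D.z, by rw [memO, D.v_z]; exact zero_le_one⟩
  let m : Ideal O := Ideal.span {z}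
  have mem_m : ∀ x : O, x ∈ m ↔ 1 ≤ D.v x := by
    intro x
    rw [D.one_le_v_iff, Ideal.mem_span_singleton']
    constructor
    · rintro ⟨a, rfl⟩
      have : ((a * z : O) : L) / D.z = a := by
        change (a : L) * D.z / D.z = a
        rw [mul_div_cancel_right₀ _ D.z_ne]
      rw [this]; exact a.2
    · intro h
      refine ⟨⟨_, h⟩, Subtype.ext ?_⟩
      exact div_mul_cancel₀ _ D.z_ne
  have hmax : m.IsMaximal := by
    rw [Ideal.isMaximal_iff]
    constructor
    · rw [mem_m]
      change ¬ 1 ≤ D.v 1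
      rw [v_one]; decide
    · intro J x _ hx hxJ
      have hx0 : D.v x = 0 := by
        have h0 : 0 ≤ D.v x := x.2
        rw [mem_m] at hx
        have hxne : (x : L) ≠ 0 := by
          intro h; rw [h, v_zero] at hx; simp at hx
        obtain ⟨j, hj⟩ := D.exists_v hxne
        rw [hj] at hx h0 ⊢
        norm_cast at hx h0 ⊢
        omega
      rw [Ideal.eq_top_of_isUnit_mem J hxJ (unitO x hx0)]
      trivial
  have h5 : Algebra.FormallySmooth k (O ⧸ m) := by
    let _ : Field (O ⧸ m) := Ideal.Quotient.field m
    exact Algebra.FormallySmooth.of_perfectField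
  have hz2 : z ∉ m ^ 2 := by
    rw [Ideal.span_singleton_pow, Ideal.mem_span_singleton']
    rintro ⟨a, ha⟩
    have ha' : (a : L) * D.z ^ 2 = D.z := congrArg Subtype.val ha
    have hane : (a : L) ≠ 0 := by
      intro h; rw [h, zero_mul] at ha'; exact D.z_ne ha'.symm
    obtain ⟨j, hj⟩ := D.exists_v hane
    have h0 : 0 ≤ D.v a := a.2
    have := D.v_mul_of hj (D.v_pow_of D.v_z_coe 2)
    rw [ha', D.v_z_coe] at this
    rw [hj] at h0
    norm_cast at this h0
    omega
  obtain ⟨φ, hφ⟩ := exists_functional k O m z rfl hz2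
  intro hmem
  have hlift : ∀ ω ∈ D.OmegaO k, ∃ ω' : Ω[O⁄k], KaehlerDifferential.map k k O L ω' = ω := by
    intro ω hω
    refine AddSubgroup.closure_induction ?_ ?_ ?_ ?_ hω
    · rintro _ ⟨a, b, ha, hb, rfl⟩
      refine ⟨(⟨a, ha⟩ : O) • KaehlerDifferential.D k O ⟨b, hb⟩, ?_⟩
      rw [map_smul, KaehlerDifferential.map_D]
      rfl
    · exact ⟨0, map_zero _⟩
    · rintro _ _ _ _ ⟨x, rfl⟩ ⟨y, rfl⟩
      exact ⟨x + y, map_add _ _ _⟩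
    · rintro _ _ ⟨x, rfl⟩
      exact ⟨-x, map_neg _ _⟩
  obtain ⟨ω, hω⟩ := hlift _ hmem
  have hker : KaehlerDifferential.map k k O L (z • ω) =
      KaehlerDifferential.map k k O L (KaehlerDifferential.D k O z) := by
    rw [map_smul, hω, KaehlerDifferential.map_D]
    change D.z • D.z⁻¹ • KaehlerDifferential.D k L D.z = KaehlerDifferential.D k L D.z
    rw [smul_smul, mul_inv_cancel₀ D.z_ne, one_smul]
  obtain ⟨c, hc⟩ := IsLocalizedModule.exists_of_eq (S := nonZeroDivisors O) hker
  have hc2 := congrArg φ hc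
  simp only [Submonoid.smul_def, map_smul, smul_eq_mul] at hc2
  have hc0 : (c : O) ≠ 0 := nonZeroDivisors.ne_zero c.2
  have := mul_left_cancel₀ hc0 hc2
  exact hφ (this ▸ Ideal.mul_mem_right _ _ (Ideal.mem_span_singleton_self z))

end DVField

namespace DVField

variable {L : Type} [Field L] (D : DVField L)

theorem filLog_cond_iff {a : L} {j : ℤ} (h : D.v a = j) (r q : ℕ) :
    (↑(-(r : ℤ)) : WithTop ℤ) ≤ q • D.v a ↔ -(r : ℤ) ≤ q * j := by
  rw [h, ← WithTop.coe_nsmul, WithTop.coe_le_coe, nsmul_eq_mul]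

theorem filLog_cond_zero (r q : ℕ) (hq : q ≠ 0) :
    (↑(-(r : ℤ)) : WithTop ℤ) ≤ q • D.v 0 := by
  obtain ⟨q, rfl⟩ := Nat.exists_eq_succ_of_ne_zero hq
  rw [v_zero, Nat.succ_eq_add_one, succ_nsmul, WithTop.add_top]
  exact le_top

variable (k : Type) [CommRing k] [Algebra k L]

theorem smul_mem_OmegaO {c : L} (hc : 0 ≤ D.v c) {ω : Ω[L⁄k]} (hω : ω ∈ D.OmegaO k) :
    c • ω ∈ D.OmegaO k := by
  refine AddSubgroup.closure_induction ?_ ?_ ?_ ?_ hω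
  · rintro _ ⟨a, b, ha, hb, rfl⟩
    refine AddSubgroup.subset_closure ⟨c * a, b, ?_, hb, smul_smul _ _ _⟩
    rw [D.v_mul]; exact add_nonneg hc ha
  · rw [smul_zero]; exact zero_mem _
  · intro x y _ _ hx hy
    rw [smul_add]; exact add_mem hx hy
  · intro x _ hx
    rw [smul_neg]; exact neg_mem hx

theorem OmegaO_le_log : D.OmegaO k ≤ D.OmegaOLog k :=
  AddSubgroup.closure_mono Set.subset_union_left

theorem dlog_unit_mem {u : L} (hu : D.v u = ((0 : ℤ) : WithTop ℤ)) :
    u⁻¹ • KaehlerDifferential.D k L u ∈ D.OmegaO k := by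
  refine AddSubgroup.subset_closure ⟨u⁻¹, u, ?_, ?_, rfl⟩
  · rw [D.v_inv_of hu]; simp
  · rw [hu]; simp

/-- Logarithmic decomposition of `a^{q-1} da`. -/
theorem term_decomp {a : L} {j : ℤ} (ha : D.v a = j) (q : ℕ) (hq : q ≠ 0) (s : ℕ) :
    ∃ ω ∈ D.OmegaO k, ∃ c : L, D.v c = ((s + q * j : ℤ) : WithTop ℤ) ∧
      D.z ^ s • a ^ (q - 1) • KaehlerDifferential.D k L a =
        c • ω + (c * (j : L)) • (D.z⁻¹ • KaehlerDifferential.D k L D.z) := by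
  have ha0 := D.ne_zero_of_v ha
  have hz := D.z_ne
  let u : L := a * D.z ^ (-j)
  have hu : D.v u = ((0 : ℤ) : WithTop ℤ) := by
    rw [D.v_mul_of ha (D.v_zpow_z (-j))]; simp
  have hu0 := D.ne_zero_of_v hu
  have hau : a = u * D.z ^ j := by
    simp only [u]
    rw [mul_assoc, ← zpow_add₀ hz]; simp
  refine ⟨_, D.dlog_unit_mem k hu, D.z ^ s * a ^ q, ?_, ?_⟩
  · rw [D.v_mul_of (D.v_pow_of D.v_z_coe s) (D.v_pow_of ha q)]; simp
  · have hda : KaehlerDifferential.D k L a =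
        a • (u⁻¹ • KaehlerDifferential.D k L u) +
          (a * (j : L)) • (D.z⁻¹ • KaehlerDifferential.D k L D.z) := by
      conv_lhs => rw [hau]
      rw [Derivation.leibniz, Derivation.leibniz_zpow, ← Int.cast_smul_eq_zsmul L j]
      simp only [smul_smul]
      rw [add_comm]
      congr 2
      · rw [hau]; field_simp
      · rw [hau, zpow_sub_one₀ hz]; ring
    rw [hda]
    obtain ⟨q, rfl⟩ := Nat.exists_eq_succ_of_ne_zero hq
    simp only [smul_add, smul_smul, Nat.succ_eq_add_one, Nat.add_sub_cancel]
    congr 2 <;> ring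

theorem term_mem_log {a : L} (q : ℕ) (hq : q ≠ 0) (s : ℕ)
    (h : (↑(-(s : ℤ)) : WithTop ℤ) ≤ q • D.v a) :
    D.z ^ s • a ^ (q - 1) • KaehlerDifferential.D k L a ∈ D.OmegaOLog k := by
  by_cases ha0 : a = 0
  · rw [ha0, map_zero, smul_zero, smul_zero]; exact zero_mem _
  obtain ⟨j, hj⟩ := D.exists_v ha0
  rw [D.filLog_cond_iff hj] at h
  obtain ⟨ω, hω, c, hc, heq⟩ := D.term_decomp k hj q hq s
  have hc0 : 0 ≤ D.v c := by rw [hc]; norm_cast; omega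
  rw [heq]
  refine add_mem (D.OmegaO_le_log k (D.smul_mem_OmegaO k hc0 hω)) ?_
  have : c * (j : L) = ((j : ℤ) : L) * c := mul_comm _ _
  rw [this, mul_smul, Int.cast_smul_eq_zsmul]
  exact (D.OmegaOLog k).zsmul_mem (AddSubgroup.subset_closure (Or.inr ⟨c, hc0, rfl⟩)) j

theorem term_mem (p : ℕ) [CharP L p] {a : L} (q : ℕ) (hq : q ≠ 0) (s : ℕ)
    (h : (↑(-(s : ℤ)) : WithTop ℤ) ≤ q • D.v a)
    (h' : ∀ j : ℤ, D.v a = j → (q : ℤ) * j = -s → (p : ℤ) ∣ j) :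
    D.z ^ s • a ^ (q - 1) • KaehlerDifferential.D k L a ∈ D.OmegaO k := by
  by_cases ha0 : a = 0
  · rw [ha0, map_zero, smul_zero, smul_zero]; exact zero_mem _
  obtain ⟨j, hj⟩ := D.exists_v ha0
  rw [D.filLog_cond_iff hj] at h
  obtain ⟨ω, hω, c, hc, heq⟩ := D.term_decomp k hj q hq s
  have hc0 : 0 ≤ D.v c := by rw [hc]; norm_cast; omega
  rw [heq]
  refine add_mem (D.smul_mem_OmegaO k hc0 hω) ?_
  by_cases hs : (q : ℤ) * j = -s
  · have : (j : L) = 0 := (CharP.intCast_eq_zero_iff L p j).mpr (h' j hj hs)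
    rw [this, mul_zero, zero_smul]; exact zero_mem _
  · have : c * (j : L) = ((j : ℤ) : L) * c := mul_comm _ _
    rw [this, mul_smul, Int.cast_smul_eq_zsmul, smul_smul]
    refine (D.OmegaO k).zsmul_mem (AddSubgroup.subset_closure ⟨_, _, ?_, ?_, rfl⟩) j
    · rw [D.v_mul_of hc (D.v_inv_of D.v_z_coe)]; norm_cast; omega
    · rw [D.v_z]; exact zero_le_one

theorem dlog_of_term (p : ℕ) [Fact p.Prime] [CharP L p] {a : L} (q : ℕ) (hq : q ≠ 0) (s : ℕ) (j : ℤ)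
    (hj : D.v a = j) (hs : (q : ℤ) * j = -s) (hpj : ¬ (p : ℤ) ∣ j)
    (hmem : D.z ^ s • a ^ (q - 1) • KaehlerDifferential.D k L a ∈ D.OmegaO k) :
    D.z⁻¹ • KaehlerDifferential.D k L D.z ∈ D.OmegaO k := by
  obtain ⟨ω, hω, c, hc, heq⟩ := D.term_decomp k hj q hq s
  have hc' : D.v c = ((0 : ℤ) : WithTop ℤ) := by rw [hc, hs]; simp
  have hjL : (j : L) ≠ 0 := fun h => hpj ((CharP.intCast_eq_zero_iff L p j).mp h)
  have hc0 := D.ne_zero_of_v hc'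
  have hvj : D.v (j : L) = ((0 : ℤ) : WithTop ℤ) := by
    have hnn : ∀ i : ℤ, 0 ≤ D.v (i : L) := fun i => intCast_mem D.oring i
    -- `j` is invertible modulo `p`
    obtain ⟨i, hi⟩ := D.exists_v hjL
    have h0 := hnn j
    have hcop : IsCoprime (p : ℤ) j := by
      exact (Nat.prime_iff_prime_int.mp Fact.out).coprime_iff_not_dvd.mpr hpj
    obtain ⟨x, y, hxy⟩ := hcop
    have hyj : (y : L) * (j : L) = 1 := by
      have := congrArg (Int.cast : ℤ → L) hxy
      push_cast at this
      simpa using this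
    have hy0 : (y : L) ≠ 0 := left_ne_zero_of_mul_eq_one hyj
    obtain ⟨l, hl⟩ := D.exists_v hy0
    have h1 := D.v_mul_of hl hi
    have h2 := hnn y
    rw [hyj, v_one] at h1
    rw [hl] at h2
    rw [hi] at h0 ⊢
    norm_cast at h0 h1 h2 ⊢
    omega
  have hcj : D.v (c * (j : L))⁻¹ = ((0 : ℤ) : WithTop ℤ) := by
    rw [D.v_inv_of (D.v_mul_of hc' hvj)]; simp
  rw [heq] at hmem
  have h1 := sub_mem hmem (D.smul_mem_OmegaO k (by rw [hc']; simp) hω)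
  rw [add_sub_cancel_left] at h1
  have h2 := D.smul_mem_OmegaO k (c := (c * (j : L))⁻¹) (by rw [hcj]; simp) h1
  rwa [smul_smul (c * (j : L))⁻¹, inv_mul_cancel₀ (mul_ne_zero hc0 hjL), one_smul] at h2

end DVField

theorem dvd_of_val_ne (p : ℕ) [Fact p.Prime] (e s : ℕ) (hs : 1 ≤ s) (he : padicValNat p s ≠ e)
    (j : ℤ) (h : ((p ^ e : ℕ) : ℤ) * j = -s) : (p : ℤ) ∣ j := by
  by_contra hj
  apply he
  have hs' : s = p ^ e * j.natAbs := by
    have := congrArg Int.natAbs h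
    rw [Int.natAbs_mul] at this
    simpa using this.symm
  have hj' : ¬ p ∣ j.natAbs := fun h => hj (Int.natCast_dvd.mpr h)
  have hj0 : j.natAbs ≠ 0 := by rintro h0; rw [h0] at hj'; simp at hj'
  rw [hs', padicValNat.mul (pow_ne_zero _ (Fact.out : p.Prime).ne_zero) hj0,
    padicValNat.prime_pow, padicValNat.eq_zero_of_not_dvd hj', add_zero]

theorem not_dvd_of_val_eq (p : ℕ) [Fact p.Prime] (e s : ℕ) (hs : 1 ≤ s) (he : padicValNat p s = e)
    (j : ℤ) (h : ((p ^ e : ℕ) : ℤ) * j = -s) : ¬ (p : ℤ) ∣ j := by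
  rintro ⟨i, rfl⟩
  have : p ^ (e + 1) ∣ s := by
    rw [← Int.natCast_dvd_natCast]
    refine ⟨-i, ?_⟩
    push_cast at h ⊢
    rw [pow_succ]
    linarith
  rw [padicValNat_dvd_iff_le (by omega)] at this
  omega

theorem le_val_of_eq (p : ℕ) [Fact p.Prime] (e s : ℕ) (hs : 1 ≤ s)
    (j : ℤ) (h : ((p ^ e : ℕ) : ℤ) * j = -s) : e ≤ padicValNat p s := by
  rw [← padicValNat_dvd_iff_le (by omega), ← Int.natCast_dvd_natCast]
  exact ⟨-j, by linarith⟩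

/-- (Characterization of the Kato–Matsuda filtration inside the
Brylinski–Kato filtration via `F^{n-1}d`.)  Let `k` be a perfect field of characteristic `p`,
`A` a smooth integral `k`-algebra with fraction field `L`, and `O = A_P` the localization at
a height-one prime, a discrete valuation ring with valuation `v` and uniformizer `z`
(encoded by: every element of `A` is integral, and every integral element of `L` is a
fraction `a/b` with `a, b ∈ A` and `v b = 0`).  Then for every `n ≥ 1` and `s ≥ 1`:
(i) `F^{n-1}d(fil^log_s Wₙ(L)) ⊆ 𝔪^{-s}·Ω¹_O(log)`;
(ii) `F^{n-1}d(fil_s Wₙ(L)) ⊆ 𝔪^{-s}·Ω¹_O`;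
(iii) if `a ∈ fil^log_s Wₙ(L)` and `F^{n-1}d(a) ∈ 𝔪^{-s}·Ω¹_O` then `a ∈ fil_s Wₙ(L)`. -/
theorem statement13 (p : ℕ) [Fact p.Prime]
    (k : Type) [Field k] [CharP k p] [PerfectField k]
    (A : Type) [CommRing A] [IsDomain A] [Algebra k A] [Algebra.Smooth k A]
    (L : Type) [Field L] [Algebra A L] [IsFractionRing A L]
    [Algebra k L] [IsScalarTower k A L]
    (D : DVField L)
    (hA1 : ∀ a : A, 0 ≤ D.v (algebraMap A L a))
    (hA2 : ∀ x : L, 0 ≤ D.v x → ∃ a b : A,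
      D.v (algebraMap A L b) = 0 ∧ x * algebraMap A L b = algebraMap A L a)
    (n s : ℕ) (hn : 1 ≤ n) (hs : 1 ≤ s) :
    (∀ a ∈ D.filLog p s n, ∃ η ∈ D.OmegaOLog k, wFd p k a = (D.z ^ s)⁻¹ • η) ∧
    (∀ a ∈ D.filKM p s n, ∃ η ∈ D.OmegaO k, wFd p k a = (D.z ^ s)⁻¹ • η) ∧
    (∀ a ∈ D.filLog p s n, (∃ η ∈ D.OmegaO k, wFd p k a = (D.z ^ s)⁻¹ • η) →
      a ∈ D.filKM p s n) := by
  have hp : p.Prime := Fact.out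
  have hq : ∀ e : ℕ, p ^ e ≠ 0 := fun e => pow_ne_zero _ hp.ne_zero
  have hchar : CharP L p := charP_of_injective_algebraMap (algebraMap k L).injective p
  have hz : D.z ^ s ≠ 0 := pow_ne_zero _ D.z_ne
  have hform : ∀ (H : AddSubgroup (Ω[L⁄k])) (ω : Ω[L⁄k]),
      (∃ η ∈ H, ω = (D.z ^ s)⁻¹ • η) ↔ D.z ^ s • ω ∈ H := by
    intro H ω
    constructor
    · rintro ⟨η, hη, rfl⟩
      rwa [smul_smul, mul_inv_cancel₀ hz, one_smul]
    · intro h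
      exact ⟨_, h, by rw [smul_smul, inv_mul_cancel₀ hz, one_smul]⟩
  -- good terms
  have good1 : ∀ (e : ℕ) (a : L),
      (↑(-((s - 1 : ℕ) : ℤ)) : WithTop ℤ) ≤ p ^ e • D.v a →
      D.z ^ s • a ^ (p ^ e - 1) • KaehlerDifferential.D k L a ∈ D.OmegaO k := by
    intro e a h
    refine D.term_mem k p _ (hq e) s (le_trans ?_ h) ?_
    · norm_cast; omega
    · intro j hj hj'
      rw [D.filLog_cond_iff hj] at h
      omega
  have good2 : ∀ (e : ℕ) (a : L), padicValNat p s ≠ e →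
      (↑(-(s : ℤ)) : WithTop ℤ) ≤ p ^ e • D.v a →
      D.z ^ s • a ^ (p ^ e - 1) • KaehlerDifferential.D k L a ∈ D.OmegaO k := by
    intro e a he h
    exact D.term_mem k p _ (hq e) s h fun j _ hj' => dvd_of_val_ne p e s hs he j hj'
  refine ⟨?_, ?_, ?_⟩
  · intro a ha
    rw [hform, wFd, Finset.smul_sum]
    exact sum_mem fun i _ => D.term_mem_log k _ (hq _) s (ha i)
  · intro x hx
    rw [DVField.filKM, if_neg (by omega)] at hx
    obtain ⟨a, ha, b, hb, rfl⟩ := hx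
    rw [hform, wFd_add, smul_add]
    refine add_mem ?_ ?_
    · rw [wFd, Finset.smul_sum]
      exact sum_mem fun i _ => good1 _ _ (ha i)
    · rw [wFd, Finset.smul_sum]
      refine sum_mem fun i _ => ?_
      rw [wVit, TruncatedWittVector.coeff_mk]
      split_ifs with h
      · have hbi := hb ⟨(i : ℕ) - (n - min (padicValNat p s) n), h.2⟩
        have hi := i.isLt
        have he : min (padicValNat p s) n - 1 - ((i : ℕ) - (n - min (padicValNat p s) n)) =
          n - 1 - (i : ℕ) := by omega
        simp only [he] at hbi
        exact good2 _ _ (by omega) hbi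
      · rw [map_zero, smul_zero, smul_zero]; exact zero_mem _
  · intro a ha hmem
    rw [hform] at hmem
    have key : ∀ i : Fin n, (i : ℕ) < n - min (padicValNat p s) n →
        (↑(-((s - 1 : ℕ) : ℤ)) : WithTop ℤ) ≤ p ^ (n - 1 - (i : ℕ)) • D.v (a.coeff i) := by
      intro i hi
      by_contra hcon
      have hai : a.coeff i ≠ 0 := by
        intro h0
        rw [h0] at hcon
        exact hcon (D.filLog_cond_zero _ _ (hq _))
      obtain ⟨j, hj⟩ := D.exists_v hai
      have h1 := ha i
      rw [D.filLog_cond_iff hj] at h1 hcon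
      have h2 : ((p ^ (n - 1 - (i : ℕ)) : ℕ) : ℤ) * j = -s := by omega
      have h3 := le_val_of_eq p _ s hs j h2
      have h4 : padicValNat p s = n - 1 - (i : ℕ) := by omega
      have h5 := not_dvd_of_val_eq p _ s hs h4 j h2
      refine D.dlog_notMem p k A hA1 hA2 (D.dlog_of_term k p _ (hq _) s j hj h2 h5 ?_)
      rw [wFd, Finset.smul_sum, ← Finset.add_sum_erase _ _ (Finset.mem_univ i)] at hmem
      refine (AddSubgroup.add_mem_cancel_right _ (sum_mem fun l hl => ?_)).mp hmem
      refine good2 _ _ ?_ (ha l)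
      have hne : l ≠ i := Finset.ne_of_mem_erase hl
      have hne' : (l : ℕ) ≠ i := fun h => hne (Fin.ext h)
      have := l.isLt
      have := i.isLt
      omega
    rw [DVField.filKM, if_neg (by omega)]
    refine ⟨TruncatedWittVector.mk p fun i =>
        if (i : ℕ) < n - min (padicValNat p s) n then a.coeff i else 0, ?_,
      TruncatedWittVector.mk p fun i =>
        a.coeff ⟨(i : ℕ) + (n - min (padicValNat p s) n), by have := i.isLt; omega⟩, ?_, ?_⟩
    · intro i
      rw [TruncatedWittVector.coeff_mk]
      split_ifs with h
      · exact key i h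
      · exact D.filLog_cond_zero _ _ (hq _)
    · intro i
      rw [TruncatedWittVector.coeff_mk]
      have hi := i.isLt
      have h1 := ha ⟨(i : ℕ) + (n - min (padicValNat p s) n), by omega⟩
      have he : n - 1 - ((i : ℕ) + (n - min (padicValNat p s) n)) =
        min (padicValNat p s) n - 1 - (i : ℕ) := by omega
      simp only [he] at h1
      exact h1
    · have hdis : ∀ i : Fin n, ¬ (i : ℕ) < n - min (padicValNat p s) n →
          (n - min (padicValNat p s) n ≤ (i : ℕ) ∧
            (i : ℕ) - (n - min (padicValNat p s) n) < min (padicValNat p s) n) := by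
        intro i h
        have := i.isLt
        omega
      ext i
      rw [tw_add_disjoint]
      · simp only [wVit, TruncatedWittVector.coeff_mk]
        by_cases h : (i : ℕ) < n - min (padicValNat p s) n
        · rw [if_pos h, dif_neg (by omega), add_zero]
        · rw [if_neg h, dif_pos (hdis i h), zero_add]
          congr 1
          apply Fin.ext
          simp only
          omega
      · intro i
        simp only [wVit, TruncatedWittVector.coeff_mk]
        by_cases h : (i : ℕ) < n - min (padicValNat p s) n
        · right; rw [dif_neg (by omega)]
        · left; rw [if_neg h]
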